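/- Let {Vᵢ}ᵢ₌₁ⁿ be VLSMs over the same message set satisfying the channel authentication, message dependencies and sent-oracle assumptions, with each component satisfying the full node assumption, and let B ⊆ {1,…,n}. If every component Vⱼ with j ∉ B is a validator for the fixed-set message-equivocation model V^B_{m_eqv}, then for every j ∉ B the traces exposed to B-fixed Byzantine behaviour coincide with the traces exposed to B-fixed equivocation behaviour, i.e., the valid traces of the induced projection Proj_j(V^B_Byz) are exactly the valid traces of Proj_j(V^B_{m_eqv}). -/

import Mathlib

set_option autoImplicit false

universe u v w

/-- A validating labelled state transition and message production system (VLSM):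
labels, a nonempty set of initial states, initial messages, a total transition
function and a validity constraint.  `Option M` plays the role of `M ∪ {⊥}`. -/
structure VLSM (L : Type u) (S : Type v) (M : Type w) where
  init : Set S
  init_ne : init.Nonempty
  initMsg : Set M
  tau : L → S → Option M → S × Option M
  beta : L → S → Option M → Prop

/-- A transition record: label, source state, input message, target state, output message. -/
structure VTrans (L : Type u) (S : Type v) (M : Type w) where
  lbl : L
  src : S
  msg : Option M
  dst : S
  out : Option M

variable {L : Type u} {S : Type v} {M : Type w}

/-- `Chain s tr sf`: the transitions of `tr` link up, starting at `s` and ending at `sf`. -/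
def Chain : S → List (VTrans L S M) → S → Prop
  | s, [], sf => s = sf
  | s, t :: ts, sf => t.src = s ∧ Chain t.dst ts sf

namespace VLSM

/-- `t` is an actual transition of `V` (the transition function agrees with `t`). -/
def IsTrans (V : VLSM L S M) (t : VTrans L S M) : Prop :=
  V.tau t.lbl t.src t.msg = (t.dst, t.out)

/-- `t` is a constrained transition of `V`. -/
def IsConstrainedTrans (V : VLSM L S M) (t : VTrans L S M) : Prop :=
  V.IsTrans t ∧ V.beta t.lbl t.src t.msg

/-- `tr` is a constrained trace of `V` reaching the state `sf`. -/
def ConstrainedTraceTo (V : VLSM L S M) (tr : List (VTrans L S M)) (sf : S) : Prop :=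
  (∀ t ∈ tr, V.IsConstrainedTrans t) ∧ ∃ s0 ∈ V.init, Chain s0 tr sf

/-- A state is constrained if some constrained trace reaches it. -/
def ConstrainedState (V : VLSM L S M) (s : S) : Prop :=
  ∃ tr, V.ConstrainedTraceTo tr s

/-- Constrained reachability, defined inductively (a state is constrained iff it is
reachable from an initial state by constrained transitions). -/
inductive ReachState (V : VLSM L S M) : S → Prop where
  | init {s} : s ∈ V.init → ReachState V s
  | step {l s m} : ReachState V s → V.beta l s m → ReachState V (V.tau l s m).1

mutual
  /-- Valid states of a VLSM. -/
  inductive ValidState (V : VLSM L S M) : S → Prop where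
    | init {s} : s ∈ V.init → ValidState V s
    | step {l s m} : ValidState V s → ValidOMsg V m → V.beta l s m →
        ValidState V (V.tau l s m).1
  /-- Valid optional messages of a VLSM (`none` is always valid). -/
  inductive ValidOMsg (V : VLSM L S M) : Option M → Prop where
    | none : ValidOMsg V Option.none
    | init {m} : m ∈ V.initMsg → ValidOMsg V (some m)
    | step {l s m} : ValidState V s → ValidOMsg V m → V.beta l s m →
        ValidOMsg V (V.tau l s m).2
end

/-- `t` is a valid transition of `V`. -/
def IsValidTrans (V : VLSM L S M) (t : VTrans L S M) : Prop :=
  V.IsConstrainedTrans t ∧ V.ValidState t.src ∧ V.ValidOMsg t.msg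

/-- `tr` is a valid trace of `V` reaching the state `sf`. -/
def ValidTraceTo (V : VLSM L S M) (tr : List (VTrans L S M)) (sf : S) : Prop :=
  (∀ t ∈ tr, V.IsValidTrans t) ∧ ∃ s0 ∈ V.init, Chain s0 tr sf

/-- `tr` is a valid trace of `V`. -/
def IsValidTrace (V : VLSM L S M) (tr : List (VTrans L S M)) : Prop :=
  ∃ sf, V.ValidTraceTo tr sf

end VLSM

/-- The message `m` is emitted (sent) on the trace `tr`. -/
def EmittedOn (tr : List (VTrans L S M)) (m : M) : Prop := ∃ t ∈ tr, t.out = some m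

/-- The message `m` is received on the trace `tr`. -/
def ReceivedOn (tr : List (VTrans L S M)) (m : M) : Prop := ∃ t ∈ tr, t.msg = some m

/-- `sent` is a sent-oracle for `V`: at every constrained state `s`, `sent s m` holds
iff `m` is emitted on every constrained trace reaching `s`. -/
def IsSentOracle (V : VLSM L S M) (sent : S → M → Prop) : Prop :=
  ∀ s, V.ConstrainedState s → ∀ m,
    (sent s m ↔ ∀ tr, V.ConstrainedTraceTo tr s → EmittedOn tr m)

/-- `recv` is a received-oracle for `V`. -/
def IsReceivedOracle (V : VLSM L S M) (recv : S → M → Prop) : Prop :=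
  ∀ s, V.ConstrainedState s → ∀ m,
    (recv s m ↔ ∀ tr, V.ConstrainedTraceTo tr s → ReceivedOn tr m)

/-- The full node assumption: whenever receiving `m` is allowed by the validity
constraint, every direct dependency of `m` has been directly observed in the state. -/
def FullNodeAssumption (V : VLSM L S M) (dep : M → M → Prop)
    (sent recv : S → M → Prop) : Prop :=
  ∀ l s m, V.beta l s (some m) → ∀ m', dep m' m → sent s m' ∨ recv s m'

section Composition

variable {ι : Type*} [DecidableEq ι] {Lf : ι → Type*} {Sf : ι → Type*}

/-- The constrained composition of an indexed family of VLSMs over the same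
message set, under the composition constraint `φ`. -/
noncomputable def comp (V : ∀ i, VLSM (Lf i) (Sf i) M)
    (φ : (Σ i, Lf i) → (∀ i, Sf i) → Option M → Prop) :
    VLSM (Σ i, Lf i) (∀ i, Sf i) M where
  init := {σ | ∀ i, σ i ∈ (V i).init}
  init_ne := ⟨fun i => ((V i).init_ne).choose, fun i => ((V i).init_ne).choose_spec⟩
  initMsg := ⋃ i, (V i).initMsg
  tau := fun l σ m =>
    (Function.update σ l.1 ((V l.1).tau l.2 (σ l.1) m).1, ((V l.1).tau l.2 (σ l.1) m).2)
  beta := fun l σ m => (V l.1).beta l.2 (σ l.1) m ∧ φ l σ m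

/-- The free composition of an indexed family of VLSMs over the same message set. -/
noncomputable def freeComp (V : ∀ i, VLSM (Lf i) (Sf i) M) :
    VLSM (Σ i, Lf i) (∀ i, Sf i) M :=
  comp V fun _ _ _ => True

/-- Component `j` is a validator for the composite VLSM `W`: every constrained
transition from a constrained state of `V j` lifts to a valid transition of `W`
with matching `j`-th state components and matching input/output messages. -/
def IsValidatorAt (V : ∀ i, VLSM (Lf i) (Sf i) M)
    (W : VLSM (Σ i, Lf i) (∀ i, Sf i) M) (j : ι) : Prop :=
  ∀ l s m, (V j).ConstrainedState s → (V j).beta l s m →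
    ∃ σ : ∀ i, Sf i, σ j = s ∧
      W.IsValidTrans ⟨⟨j, l⟩, σ, m, (W.tau ⟨j, l⟩ σ m).1, (W.tau ⟨j, l⟩ σ m).2⟩ ∧
      (W.tau ⟨j, l⟩ σ m).1 j = ((V j).tau l s m).1 ∧
      (W.tau ⟨j, l⟩ σ m).2 = ((V j).tau l s m).2

/-- The induced `j`-th projection of a composite VLSM `W`: the same VLSM as the
component `Vj`, except that its initial messages are all valid messages of `W`. -/
def projV {L' : Type*} {S' : Type*} {L2 : Type*} {S2 : Type*}
    (Vj : VLSM L' S' M) (W : VLSM L2 S2 M) : VLSM L' S' M :=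
  { Vj with initMsg := {m | W.ValidOMsg (some m)} }

/-- The projection of a composite trace on component `j`. -/
def projTrace (j : ι) (tr : List (VTrans (Σ i, Lf i) (∀ i, Sf i) M)) :
    List (VTrans (Lf j) (Sf j) M) :=
  tr.filterMap fun t =>
    if h : t.lbl.1 = j then some ⟨h ▸ t.lbl.2, t.src j, t.msg, t.dst j, t.out⟩ else none

/-- The composition constraint of the fixed-set message-equivocation model:
the only message-equivocations allowed are among the components of `E`. -/
def phiM (sender : M → ι) (sent : ∀ i, Sf i → M → Prop) (E : Set ι) :
    (Σ i, Lf i) → (∀ i, Sf i) → Option M → Prop :=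
  fun l σ m => ∀ mm, m = some mm →
    (sent (sender mm) (σ (sender mm)) mm ∨ (l.1 ∈ E ∧ sender mm ∈ E))

end Composition

/-- Labels of the equivocating VLSM associated to a VLSM: act as the `i`-th copy,
duplicate the `i`-th copy, or spawn a new machine after position `i` (1-based). -/
inductive ELabel (L : Type u) (S : Type v) where
  | act (i : ℕ) (l : L)
  | dup (i : ℕ)
  | new (i : ℕ) (s : S)

/-- The equivocating VLSM associated to a VLSM `V`: its states are (nonempty) lists
of states of `V`, and it can fork itself or spawn fresh copies at any moment. -/
noncomputable def eVLSM (V : VLSM L S M) : VLSM (ELabel L S) (List S) M where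
  init := {γ | ∃ s ∈ V.init, γ = [s]}
  init_ne := ⟨[V.init_ne.choose], V.init_ne.choose, V.init_ne.choose_spec, rfl⟩
  initMsg := V.initMsg
  tau := fun lab γ m =>
    match lab with
    | .act i l =>
      match γ[i - 1]? with
      | some s => (γ.set (i - 1) (V.tau l s m).1, (V.tau l s m).2)
      | none => (γ, Option.none)
    | .dup i =>
      match γ[i - 1]? with
      | some s => (γ.take i ++ s :: γ.drop i, Option.none)
      | none => (γ, Option.none)
    | .new i s0 => (γ.take i ++ s0 :: γ.drop i, Option.none)
  beta := fun lab γ m =>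
    match lab with
    | .act i l => 1 ≤ i ∧ i ≤ γ.length ∧ ∃ s, γ[i - 1]? = some s ∧ V.beta l s m
    | .dup i => 1 ≤ i ∧ i ≤ γ.length ∧ m = Option.none
    | .new i s0 => 1 ≤ i ∧ i ≤ γ.length ∧ m = Option.none ∧ s0 ∈ V.init

section Byzantine

variable {n : ℕ} {Lf Sf : Fin n → Type} {M : Type}

/-- State type of the `i`-th component when the components of `B` are replaced by
Byzantine components (which have a single state). -/
def byzS (B : Finset (Fin n)) (Sf : Fin n → Type) (i : Fin n) : Type :=
  if i ∈ B then PUnit else Sf i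

/-- Label type of the `i`-th component when the components of `B` are replaced by
Byzantine components (whose labels are the messages). -/
def byzL (B : Finset (Fin n)) (Lf : Fin n → Type) (M : Type) (i : Fin n) : Type :=
  if i ∈ B then M else Lf i

/-- The Byzantine component of address `i`: a single state, it can send or receive
any message at any time, but may only emit messages attributed to itself. -/
def byzMachine (sender : M → Fin n) (i : Fin n) : VLSM M PUnit M where
  init := Set.univ
  init_ne := ⟨PUnit.unit, trivial⟩
  initMsg := Set.univ
  tau := fun l _ _ => (PUnit.unit, some l)
  beta := fun l _ _ => sender l = i

/-- The family in which the components of `B` are replaced by Byzantine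
components. -/
noncomputable def byzV (B : Finset (Fin n)) (V : ∀ i, VLSM (Lf i) (Sf i) M)
    (sender : M → Fin n) (i : Fin n) : VLSM (byzL B Lf M i) (byzS B Sf i) M := by
  unfold byzL byzS
  by_cases h : i ∈ B
  · simp only [if_pos h]; exact byzMachine sender i
  · simp only [if_neg h]; exact V i

def toPlainByz (B : Finset (Fin n)) {i : Fin n} (h : i ∉ B) (x : byzS B Sf i) :
    Sf i :=
  cast (by simp only [byzS, if_neg h]) x

/-- The sent oracle on the components of the Byzantine composition: a Byzantine
component counts as having sent any message attributed to it. -/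
def sentByz (B : Finset (Fin n)) (sent : ∀ i, Sf i → M → Prop) (sender : M → Fin n)
    (i : Fin n) (x : byzS B Sf i) (m : M) : Prop :=
  if h : i ∈ B then sender m = i else sent i (toPlainByz B h x) m

/-- The constraint `φ_Byz`: non-Byzantine components may only receive messages that
have been sent by their sender component. -/
def phiByz (B : Finset (Fin n)) (sent : ∀ i, Sf i → M → Prop) (sender : M → Fin n) :
    (Σ i, byzL B Lf M i) → (∀ i, byzS B Sf i) → Option M → Prop :=
  fun l σ m => ∀ mm, m = some mm →
    (sentByz B sent sender (sender mm) (σ (sender mm)) mm ∨ l.1 ∈ B)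

/-- The Byzantine model `V^B_Byz`: the constrained composition in which the
components of `B` are Byzantine. -/
noncomputable def VByz (B : Finset (Fin n)) (V : ∀ i, VLSM (Lf i) (Sf i) M)
    (sender : M → Fin n) (sent : ∀ i, Sf i → M → Prop) :
    VLSM (Σ i, byzL B Lf M i) (∀ i, byzS B Sf i) M :=
  comp (byzV B V sender) (phiByz B sent sender)

end Byzantine

theorem Chain.append_singleton {s sf : S} {tr : List (VTrans L S M)} (h : Chain s tr sf)
    {t : VTrans L S M} (ht : t.src = sf) : Chain s (tr ++ [t]) t.dst := by
  induction tr generalizing s with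
  | nil => exact ⟨ht.trans (Eq.symm h), rfl⟩
  | cons a tr ih => exact ⟨h.1, ih h.2⟩

namespace VLSM

theorem ReachState.constrainedState {V : VLSM L S M} {s : S} (h : V.ReachState s) :
    V.ConstrainedState s := by
  induction h with
  | init h => exact ⟨[], by simp, _, h, rfl⟩
  | @step l s m _ hb ih =>
    obtain ⟨tr, htr, s0, hs0, hc⟩ := ih
    refine ⟨tr ++ [⟨l, s, m, (V.tau l s m).1, (V.tau l s m).2⟩], ?_, s0, hs0,
      hc.append_singleton rfl⟩
    intro t ht
    rcases List.mem_append.1 ht with ht | ht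
    · exact htr t ht
    · rw [List.mem_singleton.1 ht]
      exact ⟨rfl, hb⟩

theorem ValidState.reachState {V : VLSM L S M} {s : S} (h : V.ValidState s) :
    V.ReachState s :=
  ValidState.rec (motive_1 := fun s _ => V.ReachState s) (motive_2 := fun _ _ => True)
    (fun h => .init h) (fun _ _ hb ih _ => .step ih hb) trivial (fun _ => trivial)
    (fun _ _ _ _ _ => trivial) h

section Simulation

variable {L' : Type*} {S' : Type*} {A : VLSM L S M} {A' : VLSM L' S' M}

/-- A simulation of VLSMs over the same messages preserves valid messages. -/
theorem ValidOMsg.of_simulation (fL : L → L') (fS : S → S')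
    (hinit : ∀ s ∈ A.init, fS s ∈ A'.init) (hmsg : A.initMsg ⊆ A'.initMsg)
    (htau : ∀ l s m, A'.tau (fL l) (fS s) m = (fS (A.tau l s m).1, (A.tau l s m).2))
    (hbeta : ∀ l s m, A.beta l s m → A'.beta (fL l) (fS s) m)
    {m : Option M} (h : A.ValidOMsg m) : A'.ValidOMsg m :=
  ValidOMsg.rec (motive_1 := fun s _ => A'.ValidState (fS s))
    (motive_2 := fun m _ => A'.ValidOMsg m)
    (fun h => .init (hinit _ h))
    (fun {l s m} _ _ hb ihs ihm => by
      have := ValidState.step ihs ihm (hbeta l s m hb)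
      rwa [htau] at this)
    .none (fun h => .init (hmsg h))
    (fun {l s m} _ _ hb ihs ihm => by
      have := ValidOMsg.step ihs ihm (hbeta l s m hb)
      rwa [htau] at this) h

end Simulation

section Projection

variable {L₂ : Type*} {S₂ : Type*} {A : VLSM L S M} {W : VLSM L₂ S₂ M}

theorem ReachState.of_projV {s : S} (h : (projV A W).ReachState s) : A.ReachState s := by
  induction h with
  | init h => exact .init h
  | step _ hb ih => exact .step ih hb

theorem ValidOMsg.projV {m : Option M} (h : W.ValidOMsg m) : (projV A W).ValidOMsg m := by
  cases m with
  | none => exact .none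
  | some m => exact .init h

theorem ReachState.validState_projV
    (hW : ∀ l s m, A.ReachState s → A.beta l s m → W.ValidOMsg m)
    {s : S} (h : A.ReachState s) : (projV A W).ValidState s := by
  induction h with
  | init h => exact .init h
  | @step l s m h hb ih => exact ValidState.step (V := _root_.projV A W) ih (hW l s m h hb).projV hb

/-- If all messages receivable in reachable states of `A` are valid for `W`, then the valid
transitions of the induced projection are the constrained transitions from reachable states. -/
theorem isValidTrans_projV_iff
    (hW : ∀ l s m, A.ReachState s → A.beta l s m → W.ValidOMsg m) (t : VTrans L S M) :
    (projV A W).IsValidTrans t ↔ A.IsConstrainedTrans t ∧ A.ReachState t.src :=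
  ⟨fun h => ⟨h.1, h.2.1.reachState.of_projV⟩, fun h =>
    ⟨h.1, h.2.validState_projV hW, (hW _ _ _ h.2 h.1.2).projV⟩⟩

end Projection

end VLSM

theorem IsValidatorAt.validOMsg {ι : Type*} [DecidableEq ι] {Lf : ι → Type*} {Sf : ι → Type*}
    {V : ∀ i, VLSM (Lf i) (Sf i) M} {W : VLSM (Σ i, Lf i) (∀ i, Sf i) M} {j : ι}
    (h : IsValidatorAt V W j) (l : Lf j) (s : Sf j) (m : Option M)
    (hs : (V j).ReachState s) (hb : (V j).beta l s m) : W.ValidOMsg m := by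
  obtain ⟨σ, -, hv, -⟩ := h l s m hs.constrainedState hb
  exact hv.2.2

namespace VLSM

variable {L' : Type u} {S' : Type v} {A : VLSM L S M} {A' : VLSM L' S' M}

theorem mem_init_cast (hL : L = L') (hS : S = S') (h : A' ≍ A) {s : S} (hs : s ∈ A.init) :
    cast hS s ∈ A'.init := by
  subst hL hS; cases h; exact hs

theorem initMsg_eq_of_heq (hL : L = L') (hS : S = S') (h : A' ≍ A) :
    A'.initMsg = A.initMsg := by
  subst hL hS; cases h; rfl

theorem tau_cast (hL : L = L') (hS : S = S') (h : A' ≍ A) (l : L) (s : S) (m : Option M) :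
    A'.tau (cast hL l) (cast hS s) m = (cast hS (A.tau l s m).1, (A.tau l s m).2) := by
  subst hL hS; cases h; rfl

theorem beta_cast (hL : L = L') (hS : S = S') (h : A' ≍ A) {l : L} {s : S} {m : Option M}
    (hb : A.beta l s m) : A'.beta (cast hL l) (cast hS s) m := by
  subst hL hS; cases h; exact hb

end VLSM

section Byzantine

variable {n : ℕ} {Lf Sf : Fin n → Type} {M : Type} {B : Finset (Fin n)}
  (V : ∀ i, VLSM (Lf i) (Sf i) M) (sender : M → Fin n) {i : Fin n}

theorem byzL_of_notMem (h : i ∉ B) : byzL B Lf M i = Lf i := if_neg h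

theorem byzS_of_notMem (h : i ∉ B) : byzS B Sf i = Sf i := if_neg h

theorem byzV_heq_of_notMem (h : i ∉ B) : byzV B V sender i ≍ V i := by
  simp only [byzV, h, dite_false]
  exact cast_heq _ _

theorem byzV_heq_of_mem (h : i ∈ B) : byzV B V sender i ≍ byzMachine sender i := by
  simp only [byzV, h, dite_true]
  exact cast_heq _ _

theorem initMsg_byzV_of_mem (h : i ∈ B) : (byzV B V sender i).initMsg = Set.univ :=
  VLSM.initMsg_eq_of_heq (if_pos h).symm (if_pos h).symm (byzV_heq_of_mem V sender h)

/-- As soon as there is a Byzantine component, every message is valid. -/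
theorem validOMsg_VByz_of_mem (sent : ∀ i, Sf i → M → Prop) (h : i ∈ B) (m : Option M) :
    (VByz B V sender sent).ValidOMsg m := by
  cases m with
  | none => exact .none
  | some m =>
    refine .init (Set.mem_iUnion.2 ⟨i, ?_⟩)
    rw [initMsg_byzV_of_mem V sender h]
    trivial

/-- Without Byzantine components, the Byzantine model simulates the fixed-set
message-equivocation model. -/
theorem validOMsg_VByz_of_forall_notMem (sent : ∀ i, Sf i → M → Prop) (hB : ∀ i, i ∉ B)
    {m : Option M} (hm : (comp V (phiM sender sent ↑B)).ValidOMsg m) :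
    (VByz B V sender sent).ValidOMsg m := by
  have hL i : Lf i = byzL B Lf M i := (byzL_of_notMem (hB i)).symm
  have hS i : Sf i = byzS B Sf i := (byzS_of_notMem (hB i)).symm
  have hV i := byzV_heq_of_notMem V sender (hB i)
  refine hm.of_simulation (A' := VByz B V sender sent) (fun l => ⟨l.1, cast (hL l.1) l.2⟩)
    (fun σ i => cast (hS i) (σ i)) ?_ ?_ ?_ ?_
  · exact fun σ hσ i => VLSM.mem_init_cast (hL i) (hS i) (hV i) (hσ i)
  · exact Set.iUnion_mono fun i => (VLSM.initMsg_eq_of_heq (hL i) (hS i) (hV i)).ge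
  · rintro ⟨k, l⟩ σ m
    simp only [VByz, comp, VLSM.tau_cast (hL k) (hS k) (hV k)]
    refine Prod.ext ?_ rfl
    funext i
    exact (Function.apply_update (fun i => cast (hS i)) σ k _ i).symm
  · rintro ⟨k, l⟩ σ m ⟨hb, hφ⟩
    refine ⟨VLSM.beta_cast (hL k) (hS k) (hV k) hb, fun mm hmm => ?_⟩
    rcases hφ mm hmm with h | h
    · left
      simpa [sentByz, hB, toPlainByz] using h
    · exact absurd h.1 (hB k)

theorem validOMsg_VByz_of_validOMsg (sent : ∀ i, Sf i → M → Prop)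
    {m : Option M} (hm : (comp V (phiM sender sent ↑B)).ValidOMsg m) :
    (VByz B V sender sent).ValidOMsg m := by
  by_cases hB : ∃ i, i ∈ B
  · obtain ⟨i, hi⟩ := hB
    exact validOMsg_VByz_of_mem V sender sent hi m
  · exact validOMsg_VByz_of_forall_notMem V sender sent (not_exists.1 hB) hm

end Byzantine

/-- Under the full node assumption, if all non-Byzantine components are validators
for the fixed-set message-equivocation model over `B`, then the traces exposed to
`B`-fixed Byzantine behaviour coincide with the traces exposed to `B`-fixed
equivocation behaviour. -/
theorem fixed_byzantine_eq_fixed_equivocating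
    {n : ℕ} {Lf Sf : Fin n → Type} {M : Type}
    (V : ∀ i, VLSM (Lf i) (Sf i) M) (sender : M → Fin n) (dep : M → M → Prop)
    (sent recv : ∀ i, Sf i → M → Prop)
    (hsent : ∀ i, IsSentOracle (V i) (sent i))
    (hrecv : ∀ i, IsReceivedOracle (V i) (recv i))
    (hfull : ∀ i, FullNodeAssumption (V i) dep (sent i) (recv i))
    (B : Finset (Fin n))
    (hvalid : ∀ k, k ∉ B → IsValidatorAt V (comp V (phiM sender sent ↑B)) k)
    (j : Fin n) (hj : j ∉ B) :
    ∀ tr : List (VTrans (Lf j) (Sf j) M),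
      (projV (V j) (VByz B V sender sent)).IsValidTrace tr ↔
        (projV (V j) (comp V (phiM sender sent ↑B))).IsValidTrace tr := by
  intro tr
  have hW := (hvalid j hj).validOMsg
  have hByz l s m (hs : (V j).ReachState s) (hb : (V j).beta l s m) :
      (VByz B V sender sent).ValidOMsg m :=
    validOMsg_VByz_of_validOMsg V sender sent (hW l s m hs hb)
  simp only [VLSM.IsValidTrace, VLSM.ValidTraceTo, VLSM.isValidTrans_projV_iff hByz,
    VLSM.isValidTrans_projV_iff hW]
  rfl
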